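/- arXiv:2005.01110 — 18 statements merged into one kernel-verified Lean document; each statement's English description precedes it below -/
import Mathlib

section
/- Let L be a commutative associative algebra over a field of characteristic zero and let D : L → L be a derivation (a linear map with D(x·y) = D(x)·y + x·D(y)). Define [x,y] := x·D(y) − D(x)·y for all x,y ∈ L. Then (L, ·, [ , ]) is a transposed Poisson algebra; that is, [ , ] is skew-symmetric, satisfies the Jacobi identity [[x,y],z] + [[y,z],x] + [[z,x],y] = 0, and satisfies the transposed Leibniz rule 2 z·[x,y] = [z·x, y] + [x, z·y] for all x,y,z ∈ L. -/
variable {K L : Type*} [Field K] [CharZero K] [AddCommGroup L] [Module K L]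

theorem stmt0
    (mul : L →ₗ[K] L →ₗ[K] L)
    (hcomm : ∀ x y : L, mul x y = mul y x)
    (hassoc : ∀ x y z : L, mul (mul x y) z = mul x (mul y z))
    (D : L →ₗ[K] L)
    (hD : ∀ x y : L, D (mul x y) = mul (D x) y + mul x (D y))
    (br : L → L → L)
    (hbr : ∀ x y : L, br x y = mul x (D y) - mul (D x) y) :
    (∀ x y : L, br x y = - br y x) ∧
    (∀ x y z : L, br (br x y) z + br (br y z) x + br (br z x) y = 0) ∧
    (∀ x y z : L, (2 : K) • mul z (br x y) = br (mul z x) y + br x (mul z y)) := by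
  have hlc : ∀ x y z : L, mul x (mul y z) = mul y (mul x z) := by
    intro x y z
    rw [← hassoc, hcomm x y, hassoc]
  refine ⟨?_, ?_, ?_⟩
  · intro x y
    rw [hbr, hbr, hcomm x (D y), hcomm y (D x)]
    abel
  · intro x y z
    simp only [hbr, hD, map_sub, map_add, LinearMap.sub_apply, LinearMap.add_apply, hassoc]
    simp only [hcomm, hlc]
    abel
  · intro x y z
    simp only [hbr, hD, map_sub, map_add, LinearMap.sub_apply, LinearMap.add_apply, hassoc,
      two_smul]
    simp only [hcomm, hlc]
    abel
end

section
/- Let (L, ·, [ , ]) be a transposed Poisson algebra over a field of characteristic zero. Then x·[y,z] + y·[z,x] + z·[x,y] = 0 for all x,y,z ∈ L. -/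
variable {K L : Type*} [Field K] [CharZero K] [AddCommGroup L] [Module K L]

theorem stmt1
    (mul br : L →ₗ[K] L →ₗ[K] L)
    (hcomm : ∀ x y : L, mul x y = mul y x)
    (hassoc : ∀ x y z : L, mul (mul x y) z = mul x (mul y z))
    (hskew : ∀ x y : L, br x y = - br y x)
    (hjac : ∀ x y z : L, br (br x y) z + br (br y z) x + br (br z x) y = 0)
    (htl : ∀ x y z : L, (2 : K) • mul z (br x y) = br (mul z x) y + br x (mul z y)) :
    ∀ x y z : L, mul x (br y z) + mul y (br z x) + mul z (br x y) = 0 := by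
  intro x y z
  have h1 := htl y z x
  have h2 := htl z x y
  have h3 := htl x y z
  have h : (2 : K) • (mul x (br y z) + mul y (br z x) + mul z (br x y)) = 0 := by
    rw [smul_add, smul_add, h1, h2, h3, hcomm y x, hcomm z x, hcomm z y,
      hskew z (mul x y), hskew y (mul x z), hskew x (mul y z)]
    abel
  exact (smul_eq_zero.mp h).resolve_left two_ne_zero
end

section
/- Let (L, ·, [ , ]) be a transposed Poisson algebra over a field of characteristic zero. Then [h·[x,y], z] + [h·[y,z], x] + [h·[z,x], y] = 0 for all x,y,z,h ∈ L. -/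
variable {K L : Type*} [Field K] [CharZero K] [AddCommGroup L] [Module K L]

theorem stmt2
    (mul br : L →ₗ[K] L →ₗ[K] L)
    (hcomm : ∀ x y : L, mul x y = mul y x)
    (hassoc : ∀ x y z : L, mul (mul x y) z = mul x (mul y z))
    (hskew : ∀ x y : L, br x y = - br y x)
    (hjac : ∀ x y z : L, br (br x y) z + br (br y z) x + br (br z x) y = 0)
    (htl : ∀ x y z : L, (2 : K) • mul z (br x y) = br (mul z x) y + br x (mul z y)) :
    ∀ x y z h : L,
      br (mul h (br x y)) z + br (mul h (br y z)) x + br (mul h (br z x)) y = 0 := by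
  intro x y z h
  have key : ∀ a b c : L, (2 : K) • br (mul h (br a b)) c
      = br (br (mul h a) b) c + br (br a (mul h b)) c := by
    intro a b c
    have := congrArg (fun t => br t c) (htl a b h)
    simpa using this
  have j0 := congrArg (fun t => (2 : K) • mul h t) (hjac x y z)
  simp only [map_add, smul_add, map_zero, smul_zero] at j0
  rw [htl, htl, htl] at j0
  have j1 := hjac (mul h x) y z
  have j2 := hjac (mul h y) z x
  have j3 := hjac (mul h z) x y
  have k1 := key x y z
  have k2 := key y z x
  have k3 := key z x y
  linear_combination (norm := module) k1 + k2 + k3 - j0 + j1 + j2 + j3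
end

section
/- Let (L, ·, [ , ]) be a transposed Poisson algebra over a field of characteristic zero. Then [h·x, [y,z]] + [h·y, [z,x]] + [h·z, [x,y]] = 0 for all x,y,z,h ∈ L. -/
variable {K L : Type*} [Field K] [CharZero K] [AddCommGroup L] [Module K L]

theorem stmt3
    (mul br : L →ₗ[K] L →ₗ[K] L)
    (hcomm : ∀ x y : L, mul x y = mul y x)
    (hassoc : ∀ x y z : L, mul (mul x y) z = mul x (mul y z))
    (hskew : ∀ x y : L, br x y = - br y x)
    (hjac : ∀ x y z : L, br (br x y) z + br (br y z) x + br (br z x) y = 0)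
    (htl : ∀ x y z : L, (2 : K) • mul z (br x y) = br (mul z x) y + br x (mul z y)) :
    ∀ x y z h : L,
      br (mul h x) (br y z) + br (mul h y) (br z x) + br (mul h z) (br x y) = 0 := by
  intro x y z h
  simp only [two_smul] at htl
  have t1 := htl (br x y) z h
  have t2 := htl (br y z) x h
  have t3 := htl (br z x) y h
  have j0 := congrArg (mul h) (hjac x y z)
  simp only [map_add, map_zero] at j0
  have u1 := congrArg (fun w => br w z) (htl x y h)
  have u2 := congrArg (fun w => br w x) (htl y z h)
  have u3 := congrArg (fun w => br w y) (htl z x h)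
  simp only [map_add, LinearMap.add_apply] at u1 u2 u3
  have j1 := hjac (mul h x) y z
  have j2 := hjac x (mul h y) z
  have j3 := hjac x y (mul h z)
  rw [hskew (mul h x) (br y z), hskew (mul h y) (br z x), hskew (mul h z) (br x y)]
  generalize br (br x y) (mul h z) = b1 at *
  generalize br (br y z) (mul h x) = b2 at *
  generalize br (br z x) (mul h y) = b3 at *
  have e1 : br (mul h (br x y)) z + br (mul h (br y z)) x + br (mul h (br z x)) y
      + (b1 + b2 + b3) = 0 := by
    linear_combination (norm := module) (2 : ℤ) • j0 - t1 - t2 - t3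
  have e2 : (2 : ℤ) • (br (mul h (br x y)) z + br (mul h (br y z)) x + br (mul h (br z x)) y)
      + (b1 + b2 + b3) = 0 := by
    linear_combination (norm := module) u1 + u2 + u3 + j1 + j2 + j3
  linear_combination (norm := module) e2 - (2 : ℤ) • e1
end

section
/- Let (L, ·, [ , ]) be a transposed Poisson algebra over a field of characteristic zero. Then [h,x]·[y,z] + [h,y]·[z,x] + [h,z]·[x,y] = 0 for all x,y,z,h ∈ L. -/
variable {K L : Type*} [Field K] [CharZero K] [AddCommGroup L] [Module K L]

theorem stmt4
    (mul br : L →ₗ[K] L →ₗ[K] L)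
    (hcomm : ∀ x y : L, mul x y = mul y x)
    (hassoc : ∀ x y z : L, mul (mul x y) z = mul x (mul y z))
    (hskew : ∀ x y : L, br x y = - br y x)
    (hjac : ∀ x y z : L, br (br x y) z + br (br y z) x + br (br z x) y = 0)
    (htl : ∀ x y z : L, (2 : K) • mul z (br x y) = br (mul z x) y + br x (mul z y)) :
    ∀ x y z h : L,
      mul (br h x) (br y z) + mul (br h y) (br z x) + mul (br h z) (br x y) = 0 := by
  have h1 : ∀ x y z : L, mul x (br y z) + mul y (br z x) + mul z (br x y) = 0 := by
    intro x y z
    have e1 := htl y z x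
    have e2 := htl z x y
    have e3 := htl x y z
    rw [hskew y (mul x z), hcomm x z] at e1
    rw [hskew z (mul y x), hcomm y x] at e2
    rw [hskew x (mul z y), hcomm z y] at e3
    have : (2 : K) • (mul x (br y z) + mul y (br z x) + mul z (br x y)) = 0 := by
      linear_combination (norm := module) e1 + e2 + e3
    exact (smul_eq_zero.mp this).resolve_left two_ne_zero
  have h2 : ∀ h x y z : L,
      br (mul h (br x y)) z + br (mul h (br y z)) x + br (mul h (br z x)) y = 0 := by
    intro h x y z
    have a1 := htl (br x y) z h
    have a2 := htl (br y z) x h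
    have a3 := htl (br z x) y h
    have j := congrArg (fun t => (2 : K) • mul h t) (hjac x y z)
    simp only [map_add, map_zero, smul_add, smul_zero] at j
    have b1 := congrArg (fun t => br t z) (htl x y h)
    have b2 := congrArg (fun t => br t x) (htl y z h)
    have b3 := congrArg (fun t => br t y) (htl z x h)
    simp only [map_add, map_smul, LinearMap.add_apply, LinearMap.smul_apply] at b1 b2 b3
    have j1 := hjac (mul h x) y z
    have j2 := hjac (mul h y) z x
    have j3 := hjac (mul h z) x y
    linear_combination (norm := module) b1 + b2 + b3 + j1 + j2 + j3 + a1 + a2 + a3 - j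
  intro x y z h
  have c1 := htl y z (br h x)
  have c2 := htl z x (br h y)
  have c3 := htl x y (br h z)
  rw [hskew y (mul _ _)] at c1
  rw [hskew z (mul _ _)] at c2
  rw [hskew x (mul _ _)] at c3
  have g : ∀ a b c : L, br (mul (br h a) b) c - br (mul (br h b) a) c
      + br (mul h (br a b)) c = 0 := by
    intro a b c
    have := congrArg (fun t => br t c) (h1 h a b)
    rw [hskew b h] at this
    simp only [map_add, map_neg, LinearMap.add_apply, LinearMap.neg_apply, map_zero,
      LinearMap.zero_apply] at this
    rw [hcomm (br h a) b, hcomm (br h b) a]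
    linear_combination (norm := module) this
  have g1 := g x y z
  have g2 := g y z x
  have g3 := g z x y
  have k := h2 h x y z
  have : (2 : K) • (mul (br h x) (br y z) + mul (br h y) (br z x) + mul (br h z) (br x y)) = 0 := by
    linear_combination (norm := module) c1 + c2 + c3 + g1 + g2 + g3 - k
  exact (smul_eq_zero.mp this).resolve_left two_ne_zero
end

section
/- Let (L, ·, [ , ]) be a transposed Poisson algebra over a field of characteristic zero. Then [x·u, y·v] + [x·v, y·u] = 2 u·v·[x,y] for all x,y,u,v ∈ L. -/
variable {K L : Type*} [Field K] [CharZero K] [AddCommGroup L] [Module K L]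

theorem stmt5
    (mul br : L →ₗ[K] L →ₗ[K] L)
    (hcomm : ∀ x y : L, mul x y = mul y x)
    (hassoc : ∀ x y z : L, mul (mul x y) z = mul x (mul y z))
    (hskew : ∀ x y : L, br x y = - br y x)
    (hjac : ∀ x y z : L, br (br x y) z + br (br y z) x + br (br z x) y = 0)
    (htl : ∀ x y z : L, (2 : K) • mul z (br x y) = br (mul z x) y + br x (mul z y)) :
    ∀ x y u v : L,
      br (mul x u) (mul y v) + br (mul x v) (mul y u)
        = (2 : K) • mul u (mul v (br x y)) := by
  intro x y u v
  have h1 := htl (mul v x) y u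
  have h2 := htl x (mul v y) u
  have h3 := htl x y (mul u v)
  have h4 := congrArg (mul u) (htl x y v)
  rw [map_smul, map_add] at h4
  rw [hassoc, hassoc, hassoc] at h3
  rw [hcomm x u, hcomm x v, hcomm y u, hcomm y v]
  have h5 := congrArg (fun t => (2 : K) • t) h4
  simp only [smul_add] at h5
  rw [h1, h2] at h5
  have h6 : (2 : K) • (2 : K) • mul u (mul v (br x y))
      = (2 : K) • mul u (mul v (br x y)) + (2 : K) • mul u (mul v (br x y)) := two_smul K _
  rw [h6] at h5
  have h7 : br (mul u x) (mul v y) + br (mul v x) (mul u y)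
      = (br (mul u (mul v x)) y + br (mul v x) (mul u y)
        + (br (mul u x) (mul v y) + br x (mul u (mul v y))))
        - (br (mul u (mul v x)) y + br x (mul u (mul v y))) := by abel
  rw [h7, ← h5, ← h3]
  abel
end

section
/- Let (L, ·, [ , ]) be a transposed Poisson algebra over a field of characteristic zero. Then x·[u, y·v] + v·[x·y, u] + y·u·[v, x] = 0 for all x,y,u,v ∈ L. -/
variable {K L : Type*} [Field K] [CharZero K] [AddCommGroup L] [Module K L]

theorem stmt6
    (mul br : L →ₗ[K] L →ₗ[K] L)
    (hcomm : ∀ x y : L, mul x y = mul y x)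
    (hassoc : ∀ x y z : L, mul (mul x y) z = mul x (mul y z))
    (hskew : ∀ x y : L, br x y = - br y x)
    (hjac : ∀ x y z : L, br (br x y) z + br (br y z) x + br (br z x) y = 0)
    (htl : ∀ x y z : L, (2 : K) • mul z (br x y) = br (mul z x) y + br x (mul z y)) :
    ∀ x y u v : L,
      mul x (br u (mul y v)) + mul v (br (mul x y) u) + mul (mul y u) (br v x) = 0 := by
  intro x y u v
  have a1 := htl u (mul y v) x
  have a2 := htl (mul x y) u v
  have a3 := htl v x (mul y u)
  have b := congrArg (fun t => (2 : K) • mul y t) (htl v x u)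
  simp only [map_add, map_smul, smul_add] at b
  rw [htl (mul u v) x y, htl v (mul u x) y, ← hassoc y u (br v x)] at b
  rw [a3, hassoc y u v, hassoc y u x] at b
  rw [hassoc y u v, hassoc y u x] at a3
  have e1 : mul v (mul x y) = mul x (mul y v) := by
    rw [hcomm v, hassoc]
  rw [e1, hskew (mul x (mul y v)) u, hcomm v u, hcomm x y] at a2
  rw [hcomm x u] at a1
  rw [hskew (mul u v) (mul y x), hskew (mul y v) (mul u x)] at b
  have h2 : (2 : K) ≠ 0 := two_ne_zero
  rw [hcomm x y]
  have key : (2 : K) • (mul x (br u (mul y v)) + mul v (br (mul y x) u)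
      + mul (mul y u) (br v x)) = 0 := by
    rw [smul_add, smul_add, a1, a2, a3]
    rw [two_smul] at b
    have hb : br (mul y (mul u v)) x + br v (mul y (mul u x)) =
        - br (mul y x) (mul u v) - br (mul u x) (mul y v) := by
      have := congrArg (fun t => t - (br (mul y (mul u v)) x + br v (mul y (mul u x)))) b
      simp only [add_sub_cancel_right] at this
      rw [this]; abel
    rw [hb]; abel
  exact (smul_eq_zero.mp key).resolve_left h2
end

section
/- Let (L, ·, [ , ]) be a transposed Poisson algebra over a field of characteristic zero and fix h ∈ L. Define a new bilinear operation [x,y]_h := h·[x,y]. Then (L, ·, [ , ]_h) is again a transposed Poisson algebra; that is, [ , ]_h is skew-symmetric, satisfies the Jacobi identity, and satisfies 2 z·[x,y]_h = [z·x, y]_h + [x, z·y]_h for all x,y,z ∈ L. -/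
variable {K L : Type*} [Field K] [CharZero K] [AddCommGroup L] [Module K L]

theorem stmt7
    (mul br : L →ₗ[K] L →ₗ[K] L)
    (hcomm : ∀ x y : L, mul x y = mul y x)
    (hassoc : ∀ x y z : L, mul (mul x y) z = mul x (mul y z))
    (hskew : ∀ x y : L, br x y = - br y x)
    (hjac : ∀ x y z : L, br (br x y) z + br (br y z) x + br (br z x) y = 0)
    (htl : ∀ x y z : L, (2 : K) • mul z (br x y) = br (mul z x) y + br x (mul z y))
    (h : L) (brh : L → L → L)
    (hbrh : ∀ x y : L, brh x y = mul h (br x y)) :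
    (∀ x y : L, brh x y = - brh y x) ∧
    (∀ x y z : L, brh (brh x y) z + brh (brh y z) x + brh (brh z x) y = 0) ∧
    (∀ x y z : L, (2 : K) • mul z (brh x y) = brh (mul z x) y + brh x (mul z y)) := by
  have e : ∀ x y z : L, (2 : K) • br (mul h (br x y)) z
      = br (br (mul h x) y) z + br (br x (mul h y)) z := by
    intro x y z
    have := congrArg (fun w => br w z) (htl x y h)
    simpa using this
  have key : ∀ x y z : L, br (mul h (br x y)) z + br (mul h (br y z)) x
      + br (mul h (br z x)) y = 0 := by
    intro x y z
    have j := congrArg (mul h) (hjac x y z)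
    simp only [map_add, map_zero] at j
    linear_combination (norm := module) e x y z + e y z x + e z x y
      + hjac (mul h x) y z + hjac (mul h y) z x + hjac (mul h z) x y
      + htl (br x y) z h + htl (br y z) x h + htl (br z x) y h - (2 : K) • j
  refine ⟨?_, ?_, ?_⟩
  · intro x y
    rw [hbrh, hbrh, hskew x y, map_neg]
  · intro x y z
    simp only [hbrh]
    rw [← map_add, ← map_add, key, map_zero]
  · intro x y z
    simp only [hbrh]
    rw [← map_add, ← htl, map_smul, ← hassoc, ← hassoc, hcomm z h]
end

section
/- Let (L₁, ·₁, [ , ]₁) and (L₂, ·₂, [ , ]₂) be transposed Poisson algebras over a field of characteristic zero. On the tensor product L₁ ⊗ L₂ define (x₁⊗x₂)·(y₁⊗y₂) := (x₁·₁y₁) ⊗ (x₂·₂y₂) and [x₁⊗x₂, y₁⊗y₂] := [x₁,y₁]₁ ⊗ (x₂·₂y₂) + (x₁·₁y₁) ⊗ [x₂,y₂]₂, extended bilinearly. Then (L₁ ⊗ L₂, ·, [ , ]) is a transposed Poisson algebra: · is commutative and associative, [ , ] is skew-symmetric and satisfies the Jacobi identity, and 2 c·[a,b] = [c·a, b] +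 [a, c·b] for all a,b,c ∈ L₁ ⊗ L₂. -/
variable {K L₁ L₂ : Type*} [Field K] [CharZero K]
  [AddCommGroup L₁] [Module K L₁] [AddCommGroup L₂] [Module K L₂]

open TensorProduct

/-- The bilinear multiplication on `L₁ ⊗ L₂`:
`(x₁ ⊗ x₂) · (y₁ ⊗ y₂) = (x₁ ·₁ y₁) ⊗ (x₂ ·₂ y₂)`. -/
noncomputable def tensorMul (mul₁ : L₁ →ₗ[K] L₁ →ₗ[K] L₁) (mul₂ : L₂ →ₗ[K] L₂ →ₗ[K] L₂) :
    L₁ ⊗[K] L₂ →ₗ[K] L₁ ⊗[K] L₂ →ₗ[K] L₁ ⊗[K] L₂ :=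
  TensorProduct.map₂ mul₁ mul₂

/-- The bilinear bracket on `L₁ ⊗ L₂`:
`[x₁ ⊗ x₂, y₁ ⊗ y₂] = [x₁,y₁]₁ ⊗ (x₂ ·₂ y₂) + (x₁ ·₁ y₁) ⊗ [x₂,y₂]₂`. -/
noncomputable def tensorBr (mul₁ br₁ : L₁ →ₗ[K] L₁ →ₗ[K] L₁)
    (mul₂ br₂ : L₂ →ₗ[K] L₂ →ₗ[K] L₂) :
    L₁ ⊗[K] L₂ →ₗ[K] L₁ ⊗[K] L₂ →ₗ[K] L₁ ⊗[K] L₂ :=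
  TensorProduct.map₂ br₁ mul₂ + TensorProduct.map₂ mul₁ br₂

theorem stmt8
    (mul₁ br₁ : L₁ →ₗ[K] L₁ →ₗ[K] L₁)
    (hcomm₁ : ∀ x y : L₁, mul₁ x y = mul₁ y x)
    (hassoc₁ : ∀ x y z : L₁, mul₁ (mul₁ x y) z = mul₁ x (mul₁ y z))
    (hskew₁ : ∀ x y : L₁, br₁ x y = - br₁ y x)
    (hjac₁ : ∀ x y z : L₁, br₁ (br₁ x y) z + br₁ (br₁ y z) x + br₁ (br₁ z x) y = 0)
    (htl₁ : ∀ x y z : L₁, (2 : K) • mul₁ z (br₁ x y) = br₁ (mul₁ z x) y + br₁ x (mul₁ z y))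
    (mul₂ br₂ : L₂ →ₗ[K] L₂ →ₗ[K] L₂)
    (hcomm₂ : ∀ x y : L₂, mul₂ x y = mul₂ y x)
    (hassoc₂ : ∀ x y z : L₂, mul₂ (mul₂ x y) z = mul₂ x (mul₂ y z))
    (hskew₂ : ∀ x y : L₂, br₂ x y = - br₂ y x)
    (hjac₂ : ∀ x y z : L₂, br₂ (br₂ x y) z + br₂ (br₂ y z) x + br₂ (br₂ z x) y = 0)
    (htl₂ : ∀ x y z : L₂, (2 : K) • mul₂ z (br₂ x y) = br₂ (mul₂ z x) y + br₂ x (mul₂ z y)) :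
    (∀ (x₁ y₁ : L₁) (x₂ y₂ : L₂),
      tensorMul mul₁ mul₂ (x₁ ⊗ₜ[K] x₂) (y₁ ⊗ₜ[K] y₂) = mul₁ x₁ y₁ ⊗ₜ[K] mul₂ x₂ y₂) ∧
    (∀ (x₁ y₁ : L₁) (x₂ y₂ : L₂),
      tensorBr mul₁ br₁ mul₂ br₂ (x₁ ⊗ₜ[K] x₂) (y₁ ⊗ₜ[K] y₂)
        = br₁ x₁ y₁ ⊗ₜ[K] mul₂ x₂ y₂ + mul₁ x₁ y₁ ⊗ₜ[K] br₂ x₂ y₂) ∧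
    (∀ a b : L₁ ⊗[K] L₂, tensorMul mul₁ mul₂ a b = tensorMul mul₁ mul₂ b a) ∧
    (∀ a b c : L₁ ⊗[K] L₂,
      tensorMul mul₁ mul₂ (tensorMul mul₁ mul₂ a b) c
        = tensorMul mul₁ mul₂ a (tensorMul mul₁ mul₂ b c)) ∧
    (∀ a b : L₁ ⊗[K] L₂, tensorBr mul₁ br₁ mul₂ br₂ a b = - tensorBr mul₁ br₁ mul₂ br₂ b a) ∧
    (∀ a b c : L₁ ⊗[K] L₂,
      tensorBr mul₁ br₁ mul₂ br₂ (tensorBr mul₁ br₁ mul₂ br₂ a b) c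
        + tensorBr mul₁ br₁ mul₂ br₂ (tensorBr mul₁ br₁ mul₂ br₂ b c) a
        + tensorBr mul₁ br₁ mul₂ br₂ (tensorBr mul₁ br₁ mul₂ br₂ c a) b = 0) ∧
    (∀ a b c : L₁ ⊗[K] L₂,
      (2 : K) • tensorMul mul₁ mul₂ c (tensorBr mul₁ br₁ mul₂ br₂ a b)
        = tensorBr mul₁ br₁ mul₂ br₂ (tensorMul mul₁ mul₂ c a) b
          + tensorBr mul₁ br₁ mul₂ br₂ a (tensorMul mul₁ mul₂ c b)) := by
  have hM : ∀ (x₁ y₁ : L₁) (x₂ y₂ : L₂),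
      tensorMul mul₁ mul₂ (x₁ ⊗ₜ[K] x₂) (y₁ ⊗ₜ[K] y₂) = mul₁ x₁ y₁ ⊗ₜ[K] mul₂ x₂ y₂ := by
    intros; simp [tensorMul]
  have hB : ∀ (x₁ y₁ : L₁) (x₂ y₂ : L₂),
      tensorBr mul₁ br₁ mul₂ br₂ (x₁ ⊗ₜ[K] x₂) (y₁ ⊗ₜ[K] y₂)
        = br₁ x₁ y₁ ⊗ₜ[K] mul₂ x₂ y₂ + mul₁ x₁ y₁ ⊗ₜ[K] br₂ x₂ y₂ := by
    intros; simp [tensorBr]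
  refine ⟨hM, hB, ?_, ?_, ?_, ?_, ?_⟩
  · intro a b
    induction a with
    | zero => simp
    | add a a' h h' => simp only [map_add, LinearMap.add_apply, h, h']
    | tmul x₁ x₂ =>
      induction b with
      | zero => simp
      | add a a' h h' => simp only [map_add, LinearMap.add_apply, h, h']
      | tmul y₁ y₂ => rw [hM, hM, hcomm₁, hcomm₂]
  · intro a b c
    induction a with
    | zero => simp
    | add a a' h h' => simp only [map_add, LinearMap.add_apply, h, h']
    | tmul x₁ x₂ =>
      induction b with
      | zero => simp
      | add a a' h h' => simp only [map_add, LinearMap.add_apply, h, h']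
      | tmul y₁ y₂ =>
        induction c with
        | zero => simp
        | add a a' h h' => simp only [map_add, h, h']
        | tmul z₁ z₂ => simp only [hM, hassoc₁, hassoc₂]
  · intro a b
    induction a with
    | zero => simp
    | add a a' h h' => simp only [map_add, LinearMap.add_apply, h, h', neg_add]
    | tmul x₁ x₂ =>
      induction b with
      | zero => simp
      | add a a' h h' => simp only [map_add, LinearMap.add_apply, h, h', neg_add]
      | tmul y₁ y₂ =>
        rw [hB, hB, hcomm₁ x₁, hcomm₂ x₂, hskew₁ x₁, hskew₂ x₂, neg_tmul, tmul_neg, neg_add]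
  · intro a b c
    induction a with
    | zero => simp
    | add a a' h h' =>
      simp only [map_add, LinearMap.add_apply]
      have := congrArg₂ (· + ·) h h'
      simp only [add_zero] at this
      rw [← this]; abel
    | tmul x₁ x₂ =>
      induction b with
      | zero => simp
      | add a a' h h' =>
        simp only [map_add, LinearMap.add_apply]
        have := congrArg₂ (· + ·) h h'
        simp only [add_zero] at this
        rw [← this]; abel
      | tmul y₁ y₂ =>
        induction c with
        | zero => simp
        | add a a' h h' =>
          simp only [map_add, LinearMap.add_apply]
          have := congrArg₂ (· + ·) h h'
          simp only [add_zero] at this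
          rw [← this]; abel
        | tmul z₁ z₂ =>
          simp only [hB, map_add, LinearMap.add_apply]
          have e1 : mul₁ (mul₁ y₁ z₁) x₁ = mul₁ (mul₁ x₁ y₁) z₁ := by
            rw [hcomm₁, hassoc₁]
          have e2 : mul₁ (mul₁ z₁ x₁) y₁ = mul₁ (mul₁ x₁ y₁) z₁ := by
            rw [hassoc₁, hcomm₁]
          have f1 : mul₂ (mul₂ y₂ z₂) x₂ = mul₂ (mul₂ x₂ y₂) z₂ := by
            rw [hcomm₂, hassoc₂]
          have f2 : mul₂ (mul₂ z₂ x₂) y₂ = mul₂ (mul₂ x₂ y₂) z₂ := by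
            rw [hassoc₂, hcomm₂]
          rw [e1, e2, f1, f2]
          have J1 := congrArg (fun t => t ⊗ₜ[K] mul₂ (mul₂ x₂ y₂) z₂) (hjac₁ x₁ y₁ z₁)
          have J2 := congrArg (fun t => mul₁ (mul₁ x₁ y₁) z₁ ⊗ₜ[K] t) (hjac₂ x₂ y₂ z₂)
          simp only [add_tmul, tmul_add, zero_tmul, tmul_zero] at J1 J2
          have P : ∀ x y z : L₁, mul₁ (br₁ x y) z
              = (2⁻¹ : K) • (br₁ (mul₁ z x) y - br₁ (mul₁ y z) x) := by
            intro x y z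
            rw [hcomm₁ y z, sub_eq_add_neg, ← hskew₁, ← htl₁, smul_smul,
              inv_mul_cancel₀ two_ne_zero, one_smul, hcomm₁]
          have Q : ∀ x y z : L₂, mul₂ (br₂ x y) z
              = (2⁻¹ : K) • (br₂ (mul₂ z x) y - br₂ (mul₂ y z) x) := by
            intro x y z
            rw [hcomm₂ y z, sub_eq_add_neg, ← hskew₂, ← htl₂, smul_smul,
              inv_mul_cancel₀ two_ne_zero, one_smul, hcomm₂]
          simp only [P, Q, tmul_smul, smul_tmul', sub_tmul, tmul_sub, smul_sub]
          simp only [← smul_tmul']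
          rw [← add_zero (0 : L₁ ⊗[K] L₂)]
          nth_rewrite 1 [← J1]
          rw [← J2]
          abel
  · intro a b c
    induction a with
    | zero => simp
    | add a a' h h' =>
      simp only [map_add, LinearMap.add_apply, smul_add, h, h']; abel
    | tmul x₁ x₂ =>
      induction b with
      | zero => simp
      | add a a' h h' =>
        simp only [map_add, LinearMap.add_apply, smul_add, h, h']; abel
      | tmul y₁ y₂ =>
        induction c with
        | zero => simp
        | add a a' h h' =>
          simp only [map_add, LinearMap.add_apply, smul_add, h, h']; abel
        | tmul z₁ z₂ =>
          simp only [hB, hM, map_add, smul_add]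
          rw [smul_tmul', htl₁, ← tmul_smul, htl₂]
          have e : mul₁ x₁ (mul₁ z₁ y₁) = mul₁ z₁ (mul₁ x₁ y₁) := by
            rw [← hassoc₁, hcomm₁ x₁, hassoc₁]
          have f : mul₂ x₂ (mul₂ z₂ y₂) = mul₂ z₂ (mul₂ x₂ y₂) := by
            rw [← hassoc₂, hcomm₂ x₂, hassoc₂]
          rw [e, f, hassoc₁, hassoc₂]
          simp only [add_tmul, tmul_add]
          abel
end

section
/- Let (L, ·, [ , ]) be a transposed Poisson algebra over a field of characteristic zero and fix h ∈ L. Define the linear map φ_h : L → L by φ_h(x) = h·x. Then φ_h²([x,y]) = [φ_h(x), φ_h(y)] for all x,y ∈ L; that is, h·(h·[x,y]) = [h·x, h·y]. -/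
variable {K L : Type*} [Field K] [CharZero K] [AddCommGroup L] [Module K L]

theorem stmt9
    (mul br : L →ₗ[K] L →ₗ[K] L)
    (hcomm : ∀ x y : L, mul x y = mul y x)
    (hassoc : ∀ x y z : L, mul (mul x y) z = mul x (mul y z))
    (hskew : ∀ x y : L, br x y = - br y x)
    (hjac : ∀ x y z : L, br (br x y) z + br (br y z) x + br (br z x) y = 0)
    (htl : ∀ x y z : L, (2 : K) • mul z (br x y) = br (mul z x) y + br x (mul z y))
    (h : L) :
    ∀ x y : L, mul h (mul h (br x y)) = br (mul h x) (mul h y) := by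
  intro x y
  have h1 := htl x y h
  have h2 := htl (mul h x) y h
  have h3 := htl x (mul h y) h
  have h4 := htl x y (mul h h)
  rw [hassoc, hassoc, hassoc] at h4
  have h5 := congrArg (mul h) h1
  rw [map_smul, map_add] at h5
  have h6 : (2 : K) • ((2 : K) • mul h (mul h (br x y)))
      = (2 : K) • mul h (br (mul h x) y) + (2 : K) • mul h (br x (mul h y)) := by
    rw [h5, smul_add]
  rw [h2, h3, h4] at h6
  have h7 : (2 : K) • mul h (mul h (br x y)) = (2 : K) • br (mul h x) (mul h y) := by
    rw [h4]
    rw [two_smul] at h6 ⊢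
    have h8 := sub_eq_zero.mpr h6
    rw [← sub_eq_zero, ← h8]
    abel
  exact smul_right_injective L (two_ne_zero : (2 : K) ≠ 0) h7
end

section
/- Let L be a vector space over a field of characteristic zero equipped with a commutative associative bilinear product · and a Lie bracket [ , ]. Then (L, ·, [ , ]) is simultaneously a Poisson algebra and a transposed Poisson algebra if and only if x·[y,z] = 0 and [x·y, z] = 0 for all x,y,z ∈ L. -/
variable {K L : Type*} [Field K] [CharZero K] [AddCommGroup L] [Module K L]

theorem stmt10
    (mul br : L →ₗ[K] L →ₗ[K] L)
    (hcomm : ∀ x y : L, mul x y = mul y x)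
    (hassoc : ∀ x y z : L, mul (mul x y) z = mul x (mul y z))
    (hskew : ∀ x y : L, br x y = - br y x)
    (hjac : ∀ x y z : L, br (br x y) z + br (br y z) x + br (br z x) y = 0) :
    ((∀ x y z : L, br x (mul y z) = mul (br x y) z + mul y (br x z)) ∧
     (∀ x y z : L, (2 : K) • mul z (br x y) = br (mul z x) y + br x (mul z y)))
      ↔ (∀ x y z : L, mul x (br y z) = 0 ∧ br (mul x y) z = 0) := by
  constructor
  · rintro ⟨hP, hT⟩
    have sk : ∀ x y z : L, mul x (br y z) = - mul x (br z y) := by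
      intro x y z
      rw [hskew y z, map_neg]
    have sy : ∀ x y z : L, mul x (br y z) = mul y (br x z) := by
      intro x y z
      have h := hT x y z
      rw [hskew (mul z x) y, hP y z x, hP x z y, hcomm (br y z) x, hcomm (br x z) y,
        two_smul, sk z y x] at h
      have h2 : mul x (br y z) - mul y (br x z) = 0 := by
        have h3 : mul x (br y z) - mul y (br x z)
          = (-(mul z (br x y) + mul z (br x y))) + (mul x (br y z) - mul y (br x z)
            + (mul z (br x y) + mul z (br x y))) := by abel
        rw [h3]
        nth_rewrite 2 [h]
        abel
      exact sub_eq_zero.mp h2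
    have z0 : ∀ x y z : L, mul x (br y z) = 0 := by
      intro x y z
      have h : mul x (br y z) = - mul x (br y z) := by
        calc mul x (br y z) = mul y (br x z) := sy x y z
          _ = - mul y (br z x) := sk _ _ _
          _ = - mul z (br y x) := by rw [sy y z x]
          _ = mul z (br x y) := by rw [sk z y x, neg_neg]
          _ = mul x (br z y) := sy _ _ _
          _ = - mul x (br y z) := sk _ _ _
      have h2 : (2 : K) • mul x (br y z) = 0 := by
        rw [two_smul]
        nth_rewrite 1 [h]
        exact neg_add_cancel _
      exact (smul_eq_zero.mp h2).resolve_left two_ne_zero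
    intro x y z
    refine ⟨z0 x y z, ?_⟩
    rw [hskew, hP, hcomm (br z x) y, z0, z0, add_zero, neg_zero]
  · intro h
    have h1 : ∀ x y z : L, mul x (br y z) = 0 := fun x y z => (h x y z).1
    have h2 : ∀ x y z : L, br (mul x y) z = 0 := fun x y z => (h x y z).2
    have h3 : ∀ x y z : L, br z (mul x y) = 0 := fun x y z => by
      rw [hskew, h2, neg_zero]
    refine ⟨fun x y z => ?_, fun x y z => ?_⟩
    · rw [h3, hcomm, h1, h1, add_zero]
    · rw [h1, h2, h3, add_zero, smul_zero]
end

section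
/- Let (L, ·, ∘) be a Novikov–Poisson algebra over a field of characteristic zero. Define [x,y] := x∘y − y∘x. Then (L, ·, [ , ]) is a transposed Poisson algebra; in particular the transposed Leibniz rule 2 z·[x,y] = [z·x, y] + [x, z·y] holds for all x,y,z ∈ L. -/
variable {K L : Type*} [Field K] [CharZero K] [AddCommGroup L] [Module K L]

theorem stmt11
    (mul circ : L →ₗ[K] L →ₗ[K] L)
    (hcomm : ∀ x y : L, mul x y = mul y x)
    (hassoc : ∀ x y z : L, mul (mul x y) z = mul x (mul y z))
    (hpre : ∀ x y z : L,
      circ (circ x y) z - circ (circ y x) z = circ x (circ y z) - circ y (circ x z))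
    (hcompat1 : ∀ x y z : L, circ (mul x y) z = mul x (circ y z))
    (hcompat2 : ∀ x y z : L,
      mul (circ x y) z - mul (circ y x) z = circ x (mul y z) - circ y (mul x z))
    (hnov : ∀ x y z : L, circ (circ x y) z = circ (circ x z) y)
    (br : L → L → L)
    (hbr : ∀ x y : L, br x y = circ x y - circ y x) :
    (∀ x y : L, br x y = - br y x) ∧
    (∀ x y z : L, br (br x y) z + br (br y z) x + br (br z x) y = 0) ∧
    (∀ x y z : L, (2 : K) • mul z (br x y) = br (mul z x) y + br x (mul z y)) := by
  refine ⟨fun x y => ?_, fun x y z => ?_, fun x y z => ?_⟩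
  · rw [hbr, hbr]; abel
  · simp only [hbr, map_sub, LinearMap.sub_apply, hpre]
    abel
  · rw [hbr, hbr, hbr, hcompat1, hcompat1, two_smul, hcomm z x, hcomm z y, map_sub]
    have h := hcompat2 x y z
    rw [hcomm _ z, hcomm _ z] at h
    have h2 : circ x (mul y z) = mul z (circ x y) - mul z (circ y x) + circ y (mul x z) := by
      rw [h]; abel
    rw [h2]
    abel
end

section
/- Let (L, ·, ∘) be a pre-Lie Poisson algebra over a field of characteristic zero. Define [x,y] := x∘y − y∘x. Then (L, ·, [ , ]) is a transposed Poisson algebra; in particular [ , ] is skew-symmetric, satisfies the Jacobi identity, and the transposed Leibniz rule 2 z·[x,y] = [z·x, y] + [x, z·y] holds for all x,y,z ∈ L. -/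
variable {K L : Type*} [Field K] [CharZero K] [AddCommGroup L] [Module K L]

theorem stmt14
    (mul circ : L →ₗ[K] L →ₗ[K] L)
    (hcomm : ∀ x y : L, mul x y = mul y x)
    (hassoc : ∀ x y z : L, mul (mul x y) z = mul x (mul y z))
    (hpre : ∀ x y z : L,
      circ (circ x y) z - circ (circ y x) z = circ x (circ y z) - circ y (circ x z))
    (hcompat1 : ∀ x y z : L, circ (mul x y) z = mul x (circ y z))
    (hcompat2 : ∀ x y z : L,
      mul (circ x y) z - mul (circ y x) z = circ x (mul y z) - circ y (mul x z))
    (br : L → L → L)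
    (hbr : ∀ x y : L, br x y = circ x y - circ y x) :
    (∀ x y : L, br x y = - br y x) ∧
    (∀ x y z : L, br (br x y) z + br (br y z) x + br (br z x) y = 0) ∧
    (∀ x y z : L, (2 : K) • mul z (br x y) = br (mul z x) y + br x (mul z y)) := by
  refine ⟨fun x y => ?_, fun x y z => ?_, fun x y z => ?_⟩
  · rw [hbr, hbr]; abel
  · simp only [hbr, map_sub, LinearMap.sub_apply]
    rw [hpre x y z, hpre y z x, hpre z x y]
    abel
  · have h := hcompat2 x y z
    rw [hcomm (circ x y) z, hcomm (circ y x) z, hcomm y z, hcomm x z] at h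
    rw [two_smul, hbr, hbr, hbr, hcompat1, hcompat1, map_sub]
    nth_rewrite 2 [h]
    abel
end

section
/- Let (L₁, ·, ∘) and (L₂, ·, ∘) be pre-Lie Poisson algebras over a field of characteristic zero. On L₁ ⊗ L₂ define (x₁⊗x₂)·(y₁⊗y₂) := (x₁·y₁) ⊗ (x₂·y₂) and (x₁⊗x₂)∘(y₁⊗y₂) := (x₁∘y₁) ⊗ (x₂·y₂) + (x₁·y₁) ⊗ (x₂∘y₂), extended bilinearly. Then (L₁ ⊗ L₂, ·, ∘) is a pre-Lie Poisson algebra: · is commutative associative, ∘ satisfies the pre-Lie identity (a∘b)∘c − (b∘a)∘c = a∘(b∘c) − b∘(a∘c), and (a·b)∘c = a·(b∘c) and (a∘b)·c − (b∘a)·c = a∘(b·c) − b∘(a·c) hold for all a,b,c ∈ L₁ ⊗ L₂. -/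
variable {K L₁ L₂ : Type*} [Field K] [CharZero K]
  [AddCommGroup L₁] [Module K L₁] [AddCommGroup L₂] [Module K L₂]

open TensorProduct

/-- The bilinear pre-Lie operation on `L₁ ⊗ L₂`:
`(x₁ ⊗ x₂) ∘ (y₁ ⊗ y₂) = (x₁ ∘ y₁) ⊗ (x₂ · y₂) + (x₁ · y₁) ⊗ (x₂ ∘ y₂)`. -/
noncomputable def tensorCirc (mul₁ circ₁ : L₁ →ₗ[K] L₁ →ₗ[K] L₁)
    (mul₂ circ₂ : L₂ →ₗ[K] L₂ →ₗ[K] L₂) :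
    L₁ ⊗[K] L₂ →ₗ[K] L₁ ⊗[K] L₂ →ₗ[K] L₁ ⊗[K] L₂ :=
  TensorProduct.map₂ circ₁ mul₂ + TensorProduct.map₂ mul₁ circ₂

theorem stmt15
    (mul₁ circ₁ : L₁ →ₗ[K] L₁ →ₗ[K] L₁)
    (hcomm₁ : ∀ x y : L₁, mul₁ x y = mul₁ y x)
    (hassoc₁ : ∀ x y z : L₁, mul₁ (mul₁ x y) z = mul₁ x (mul₁ y z))
    (hpre₁ : ∀ x y z : L₁,
      circ₁ (circ₁ x y) z - circ₁ (circ₁ y x) z = circ₁ x (circ₁ y z) - circ₁ y (circ₁ x z))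
    (hcompat1₁ : ∀ x y z : L₁, circ₁ (mul₁ x y) z = mul₁ x (circ₁ y z))
    (hcompat2₁ : ∀ x y z : L₁,
      mul₁ (circ₁ x y) z - mul₁ (circ₁ y x) z = circ₁ x (mul₁ y z) - circ₁ y (mul₁ x z))
    (mul₂ circ₂ : L₂ →ₗ[K] L₂ →ₗ[K] L₂)
    (hcomm₂ : ∀ x y : L₂, mul₂ x y = mul₂ y x)
    (hassoc₂ : ∀ x y z : L₂, mul₂ (mul₂ x y) z = mul₂ x (mul₂ y z))
    (hpre₂ : ∀ x y z : L₂,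
      circ₂ (circ₂ x y) z - circ₂ (circ₂ y x) z = circ₂ x (circ₂ y z) - circ₂ y (circ₂ x z))
    (hcompat1₂ : ∀ x y z : L₂, circ₂ (mul₂ x y) z = mul₂ x (circ₂ y z))
    (hcompat2₂ : ∀ x y z : L₂,
      mul₂ (circ₂ x y) z - mul₂ (circ₂ y x) z = circ₂ x (mul₂ y z) - circ₂ y (mul₂ x z)) :
    (∀ (x₁ y₁ : L₁) (x₂ y₂ : L₂),
      tensorMul mul₁ mul₂ (x₁ ⊗ₜ[K] x₂) (y₁ ⊗ₜ[K] y₂) = mul₁ x₁ y₁ ⊗ₜ[K] mul₂ x₂ y₂) ∧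
    (∀ (x₁ y₁ : L₁) (x₂ y₂ : L₂),
      tensorCirc mul₁ circ₁ mul₂ circ₂ (x₁ ⊗ₜ[K] x₂) (y₁ ⊗ₜ[K] y₂)
        = circ₁ x₁ y₁ ⊗ₜ[K] mul₂ x₂ y₂ + mul₁ x₁ y₁ ⊗ₜ[K] circ₂ x₂ y₂) ∧
    (∀ a b : L₁ ⊗[K] L₂, tensorMul mul₁ mul₂ a b = tensorMul mul₁ mul₂ b a) ∧
    (∀ a b c : L₁ ⊗[K] L₂,
      tensorMul mul₁ mul₂ (tensorMul mul₁ mul₂ a b) c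
        = tensorMul mul₁ mul₂ a (tensorMul mul₁ mul₂ b c)) ∧
    (∀ a b c : L₁ ⊗[K] L₂,
      tensorCirc mul₁ circ₁ mul₂ circ₂ (tensorCirc mul₁ circ₁ mul₂ circ₂ a b) c
        - tensorCirc mul₁ circ₁ mul₂ circ₂ (tensorCirc mul₁ circ₁ mul₂ circ₂ b a) c
        = tensorCirc mul₁ circ₁ mul₂ circ₂ a (tensorCirc mul₁ circ₁ mul₂ circ₂ b c)
          - tensorCirc mul₁ circ₁ mul₂ circ₂ b (tensorCirc mul₁ circ₁ mul₂ circ₂ a c)) ∧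
    (∀ a b c : L₁ ⊗[K] L₂,
      tensorCirc mul₁ circ₁ mul₂ circ₂ (tensorMul mul₁ mul₂ a b) c
        = tensorMul mul₁ mul₂ a (tensorCirc mul₁ circ₁ mul₂ circ₂ b c)) ∧
    (∀ a b c : L₁ ⊗[K] L₂,
      tensorMul mul₁ mul₂ (tensorCirc mul₁ circ₁ mul₂ circ₂ a b) c
        - tensorMul mul₁ mul₂ (tensorCirc mul₁ circ₁ mul₂ circ₂ b a) c
        = tensorCirc mul₁ circ₁ mul₂ circ₂ a (tensorMul mul₁ mul₂ b c)
          - tensorCirc mul₁ circ₁ mul₂ circ₂ b (tensorMul mul₁ mul₂ a c)) := by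
  have hM : ∀ (x₁ y₁ : L₁) (x₂ y₂ : L₂),
      tensorMul mul₁ mul₂ (x₁ ⊗ₜ[K] x₂) (y₁ ⊗ₜ[K] y₂) = mul₁ x₁ y₁ ⊗ₜ[K] mul₂ x₂ y₂ := by
    intro x₁ y₁ x₂ y₂
    simp [tensorMul]
  have hC : ∀ (x₁ y₁ : L₁) (x₂ y₂ : L₂),
      tensorCirc mul₁ circ₁ mul₂ circ₂ (x₁ ⊗ₜ[K] x₂) (y₁ ⊗ₜ[K] y₂)
        = circ₁ x₁ y₁ ⊗ₜ[K] mul₂ x₂ y₂ + mul₁ x₁ y₁ ⊗ₜ[K] circ₂ x₂ y₂ := by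
    intro x₁ y₁ x₂ y₂
    simp [tensorCirc]
  have ind : ∀ P : L₁ ⊗[K] L₂ → L₁ ⊗[K] L₂ → L₁ ⊗[K] L₂ → L₁ ⊗[K] L₂,
      (∀ a a' b c, P (a + a') b c = P a b c + P a' b c) →
      (∀ a b b' c, P a (b + b') c = P a b c + P a b' c) →
      (∀ a b c c', P a b (c + c') = P a b c + P a b c') →
      (∀ x₁ y₁ z₁ x₂ y₂ z₂, P (x₁ ⊗ₜ[K] x₂) (y₁ ⊗ₜ[K] y₂) (z₁ ⊗ₜ[K] z₂) = 0) →
      ∀ a b c, P a b c = 0 := by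
    intro P ha hb hc h a b c
    induction a using TensorProduct.induction_on with
    | zero => simpa using ha 0 0 b c
    | add a a' h1 h2 => rw [ha, h1, h2, add_zero]
    | tmul x₁ x₂ =>
      induction b using TensorProduct.induction_on with
      | zero => simpa using hb (x₁ ⊗ₜ[K] x₂) 0 0 c
      | add a a' h1 h2 => rw [hb, h1, h2, add_zero]
      | tmul y₁ y₂ =>
        induction c using TensorProduct.induction_on with
        | zero => simpa using hc (x₁ ⊗ₜ[K] x₂) (y₁ ⊗ₜ[K] y₂) 0 0
        | add a a' h1 h2 => rw [hc, h1, h2, add_zero]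
        | tmul z₁ z₂ => exact h _ _ _ _ _ _
  refine ⟨hM, hC, ?_, ?_, ?_, ?_, ?_⟩
  · intro a b
    induction a using TensorProduct.induction_on with
    | zero => simp
    | add a a' h1 h2 => simp [h1, h2]
    | tmul x₁ x₂ =>
      induction b using TensorProduct.induction_on with
      | zero => simp
      | add a a' h1 h2 => simp [h1, h2]
      | tmul y₁ y₂ => rw [hM, hM, hcomm₁, hcomm₂]
  · intro a b c
    rw [← sub_eq_zero]
    revert a b c
    apply ind
    iterate 3
      · intros
        simp only [map_add, LinearMap.add_apply]
        abel
    intro x₁ y₁ z₁ x₂ y₂ z₂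
    simp only [hM, hassoc₁, hassoc₂, sub_self]
  · intro a b c
    rw [← sub_eq_zero]
    revert a b c
    apply ind
    iterate 3
      · intros
        simp only [map_add, LinearMap.add_apply]
        abel
    intro x₁ y₁ z₁ x₂ y₂ z₂
    simp only [hC, map_add, LinearMap.add_apply]
    have e1 := eq_add_of_sub_eq (hpre₁ x₁ y₁ z₁)
    have e2 := eq_add_of_sub_eq (hpre₂ x₂ y₂ z₂)
    have f1 := eq_add_of_sub_eq (hcompat2₁ x₁ y₁ z₁)
    have f2 := eq_add_of_sub_eq (hcompat2₂ x₂ y₂ z₂)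
    have g1 : mul₁ y₁ (circ₁ x₁ z₁) = mul₁ x₁ (circ₁ y₁ z₁) := by
      rw [← hcompat1₁, ← hcompat1₁, hcomm₁]
    have g2 : mul₂ y₂ (circ₂ x₂ z₂) = mul₂ x₂ (circ₂ y₂ z₂) := by
      rw [← hcompat1₂, ← hcompat1₂, hcomm₂]
    have k1 : mul₁ y₁ (mul₁ x₁ z₁) = mul₁ x₁ (mul₁ y₁ z₁) := by
      rw [← hassoc₁, ← hassoc₁, hcomm₁ x₁]
    have k2 : mul₂ y₂ (mul₂ x₂ z₂) = mul₂ x₂ (mul₂ y₂ z₂) := by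
      rw [← hassoc₂, ← hassoc₂, hcomm₂ x₂]
    simp only [e1, e2, f1, f2, hassoc₁, hassoc₂, hcompat1₁, hcompat1₂, g1, g2, k1, k2,
      TensorProduct.add_tmul, TensorProduct.tmul_add, TensorProduct.sub_tmul,
      TensorProduct.tmul_sub]
    abel
  · intro a b c
    rw [← sub_eq_zero]
    revert a b c
    apply ind
    iterate 3
      · intros
        simp only [map_add, LinearMap.add_apply]
        abel
    intro x₁ y₁ z₁ x₂ y₂ z₂
    simp only [hM, hC, map_add, hassoc₁, hassoc₂, hcompat1₁, hcompat1₂, sub_self]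
  · intro a b c
    rw [← sub_eq_zero]
    revert a b c
    apply ind
    iterate 3
      · intros
        simp only [map_add, LinearMap.add_apply]
        abel
    intro x₁ y₁ z₁ x₂ y₂ z₂
    simp only [hM, hC, map_add, LinearMap.add_apply]
    have f1 := eq_add_of_sub_eq (hcompat2₁ x₁ y₁ z₁)
    have f2 := eq_add_of_sub_eq (hcompat2₂ x₂ y₂ z₂)
    have k1 : mul₁ y₁ (mul₁ x₁ z₁) = mul₁ x₁ (mul₁ y₁ z₁) := by
      rw [← hassoc₁, ← hassoc₁, hcomm₁ x₁]
    have k2 : mul₂ y₂ (mul₂ x₂ z₂) = mul₂ x₂ (mul₂ y₂ z₂) := by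
      rw [← hassoc₂, ← hassoc₂, hcomm₂ x₂]
    simp only [f1, f2, hassoc₁, hassoc₂, k1, k2,
      TensorProduct.add_tmul, TensorProduct.tmul_add, TensorProduct.sub_tmul,
      TensorProduct.tmul_sub]
    abel
end

section
/- Let (L, ·, [ , ]) be a transposed Poisson algebra over a field of characteristic zero and let D : L → L be a linear map that is simultaneously a derivation of (L,·) and of (L,[ , ]) (i.e. D(x·y) = D(x)·y + x·D(y) and D([x,y]) = [D(x),y] + [x,D(y)]). Define the ternary operation [x,y,z] := D(x)·[y,z] + D(y)·[z,x] + D(z)·[x,y]. Then (L, [ , , ]) is a 3-Lie algebra: [ , , ] is trilinear, alternating, and satisfies the Fundamental Identity [[x,y,z],u,v] = [[x,u,v],y,z] + [[y,u,v],z,x] + [[z,u,v],x,y] for all x,y,z,u,v ∈ L. -/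
set_option maxHeartbeats 4000000
set_option linter.unusedSimpArgs false

variable {K L : Type*} [Field K] [CharZero K] [AddCommGroup L] [Module K L]

theorem stmt16
    (mul br : L →ₗ[K] L →ₗ[K] L)
    (hcomm : ∀ x y : L, mul x y = mul y x)
    (hassoc : ∀ x y z : L, mul (mul x y) z = mul x (mul y z))
    (hskew : ∀ x y : L, br x y = - br y x)
    (hjac : ∀ x y z : L, br (br x y) z + br (br y z) x + br (br z x) y = 0)
    (htl : ∀ x y z : L, (2 : K) • mul z (br x y) = br (mul z x) y + br x (mul z y))
    (D : L →ₗ[K] L)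
    (hDmul : ∀ x y : L, D (mul x y) = mul (D x) y + mul x (D y))
    (hDbr : ∀ x y : L, D (br x y) = br (D x) y + br x (D y))
    (t : L → L → L → L)
    (ht : ∀ x y z : L,
      t x y z = mul (D x) (br y z) + mul (D y) (br z x) + mul (D z) (br x y)) :
    (∀ x y z : L, t x y z = - t y x z) ∧
    (∀ x y z : L, t x y z = - t x z y) ∧
    (∀ x y z u v : L,
      t (t x y z) u v = t (t x u v) y z + t (t y u v) z x + t (t z u v) x y) := by
  have hlc : ∀ a b c : L, mul a (mul b c) = mul b (mul a c) := by
    intro a b c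
    rw [← hassoc, hcomm a b, hassoc]
  obtain ⟨f, hf⟩ : ∃ f : L →ₗ[K] L →ₗ[K] L, ∀ a b, br a b = f a b - f b a := by
    refine ⟨(1/2 : K) • br, fun a b => ?_⟩
    simp only [LinearMap.smul_apply]
    rw [hskew b a]
    module
  have L1 : ∀ a b c : L, mul a (br b c) + mul b (br c a) + mul c (br a b) = 0 := by
    intro a b c
    linear_combination (norm := skip) (1/2 : K) • (htl a b c) + (1/2 : K) • (htl b c a) + (-1/2 : K) • (htl a c b)
    simp only [hf, map_add, map_sub, map_neg, map_smul, map_zero, LinearMap.add_apply, LinearMap.sub_apply, LinearMap.neg_apply, LinearMap.smul_apply, LinearMap.zero_apply, hassoc, hcomm, hlc]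
    module
  have L3 : ∀ h a b c : L, br (mul h (br a b)) c + br (mul h (br b c)) a + br (mul h (br c a)) b = 0 := by
    intro h a b c
    linear_combination (norm := skip) (-1 : K) • (congrArg (br a) (htl b c h)) + (1 : K) • (congrArg (br b) (htl a c h)) + (-1 : K) • (congrArg (br c) (htl a b h)) + (1 : K) • (hjac (mul a h) b c) + (-1 : K) • (htl a (br b c) h) + (-2 : K) • (congrArg (mul h) (hjac a b c)) + (1 : K) • (hjac (mul c h) a b) + (1 : K) • (htl (br a b) c h) + (-1 : K) • (htl (br a c) b h) + (-1 : K) • (hjac (mul b h) a c)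
    simp only [hf, map_add, map_sub, map_neg, map_smul, map_zero, LinearMap.add_apply, LinearMap.sub_apply, LinearMap.neg_apply, LinearMap.smul_apply, LinearMap.zero_apply, hassoc, hcomm, hlc]
    module
  have L5 : ∀ h a b c : L, mul (br h a) (br b c) + mul (br h b) (br c a) + mul (br h c) (br a b) = 0 := by
    intro h a b c
    linear_combination (norm := skip) (-1/4 : K) • (congrArg (br c) (L1 h a b)) + (-1/4 : K) • (htl b c (br a h)) + (1/4 : K) • (congrArg (br b) (L1 h a c)) + (-1/4 : K) • (congrArg (br a) (L1 h b c)) + (1/4 : K) • (htl a c (br b h)) + (-1/4 : K) • (htl a b (br c h)) + (1/4 : K) • (htl h a (br b c)) + (-1/4 : K) • (htl h b (br a c)) + (1/4 : K) • (htl h c (br a b)) + (1/4 : K) • (congrArg (br h) (L1 a b c))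
    simp only [hf, map_add, map_sub, map_neg, map_smul, map_zero, LinearMap.add_apply, LinearMap.sub_apply, LinearMap.neg_apply, LinearMap.smul_apply, LinearMap.zero_apply, hassoc, hcomm, hlc]
    module
  have L6 : ∀ a b c d : L, br (mul a c) (mul b d) + br (mul a d) (mul b c) - (2 : K) • mul (mul c d) (br a b) = 0 := by
    intro a b c d
    linear_combination (norm := skip) (1 : K) • (htl a b (mul c d)) + (-1 : K) • (htl (mul a c) b d) + (-2 : K) • (congrArg (mul d) (htl a b c)) + (-1 : K) • (htl a (mul b c) d)
    simp only [hf, map_add, map_sub, map_neg, map_smul, map_zero, LinearMap.add_apply, LinearMap.sub_apply, LinearMap.neg_apply, LinearMap.smul_apply, LinearMap.zero_apply, hassoc, hcomm, hlc]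
    module
  have P0 : ∀ a b c d e : L, - mul (mul a (br b c)) (br d e) - mul (mul a (br b d)) (br e c) - mul (mul a (br b e)) (br c d) = 0 := by
    intro a b c d e
    linear_combination (norm := skip) (-1 : K) • (congrArg (mul a) (L5 b c d e))
    simp only [hf, map_add, map_sub, map_neg, map_smul, map_zero, LinearMap.add_apply, LinearMap.sub_apply, LinearMap.neg_apply, LinearMap.smul_apply, LinearMap.zero_apply, hassoc, hcomm, hlc]
    module
  have P1 : ∀ a b c d e : L, mul (mul a (br b e)) (br c d) + mul (mul b (br e a)) (br c d) - mul b (br e (mul a (br c d))) - mul a (br (mul b (br c d)) e) = 0 := by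
    intro a b c d e
    linear_combination (norm := skip) (1/2 : K) • (L6 a e b (br c d)) + (-1/2 : K) • (L6 b e a (br c d)) + (1/2 : K) • (htl (mul a (br c d)) e b) + (-1/2 : K) • (htl (mul b (br c d)) e a)
    simp only [hf, map_add, map_sub, map_neg, map_smul, map_zero, LinearMap.add_apply, LinearMap.sub_apply, LinearMap.neg_apply, LinearMap.smul_apply, LinearMap.zero_apply, hassoc, hcomm, hlc]
    module
  have P2 : ∀ a b c d e : L, mul a (br c (mul b (br d e))) - mul (mul b (br a c)) (br d e) - mul (mul a (br c b)) (br d e) - mul b (br (mul a (br c d)) e) - mul b (br d (mul a (br c e))) = 0 := by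
    intro a b c d e
    linear_combination (norm := skip) (-1 : K) • (congrArg (mul b) (L3 a c d e)) + (1/2 : K) • (L6 a b c (br d e)) + (1/2 : K) • (htl (mul a (br d e)) c b) + (-1/2 : K) • (htl (mul b (br d e)) c a) + (1 : K) • (congrArg (mul (br d e)) (L1 a b c))
    simp only [hf, map_add, map_sub, map_neg, map_smul, map_zero, LinearMap.add_apply, LinearMap.sub_apply, LinearMap.neg_apply, LinearMap.smul_apply, LinearMap.zero_apply, hassoc, hcomm, hlc]
    module
  refine ⟨fun x y z => ?_, fun x y z => ?_, fun x y z u v => ?_⟩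
  · simp only [ht, hf, map_add, map_sub, map_neg, map_smul, map_zero, LinearMap.add_apply, LinearMap.sub_apply, LinearMap.neg_apply, LinearMap.smul_apply, LinearMap.zero_apply, hassoc, hcomm, hlc]
    module
  · simp only [ht, hf, map_add, map_sub, map_neg, map_smul, map_zero, LinearMap.add_apply, LinearMap.sub_apply, LinearMap.neg_apply, LinearMap.smul_apply, LinearMap.zero_apply, hassoc, hcomm, hlc]
    module
  · linear_combination (norm := skip) (1 : K) • (P0 (D (D u)) v x y z)
      + (-1 : K) • (P0 (D (D v)) u x y z)
      + (1 : K) • (P1 (D x) (D y) u v z)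
      + (-1 : K) • (P1 (D x) (D z) u v y)
      + (1 : K) • (P1 (D y) (D z) u v x)
      + (1 : K) • (P2 (D u) (D x) v y z)
      + (-1 : K) • (P2 (D u) (D y) v x z)
      + (1 : K) • (P2 (D u) (D z) v x y)
      + (-1 : K) • (P2 (D v) (D x) u y z)
      + (1 : K) • (P2 (D v) (D y) u x z)
      + (-1 : K) • (P2 (D v) (D z) u x y)
      + (1 : K) • (P0 (D u) (D v) x y z) + (-1 : K) • (P0 (D v) (D u) x y z)
    simp only [ht, hDmul, hDbr, map_add, LinearMap.add_apply]
    simp only [hf, map_add, map_sub, map_neg, map_smul, map_zero, LinearMap.add_apply, LinearMap.sub_apply, LinearMap.neg_apply, LinearMap.smul_apply, LinearMap.zero_apply, hassoc, hcomm, hlc]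
    module
end

section
/- Let (L, ·, [ , ]) be a transposed Poisson algebra over a field of characteristic zero and let D : L → L be a linear map that is simultaneously a derivation of (L,·) and of (L,[ , ]). Define the ternary operation [x,y,z] := D(x)·[y,z] + D(y)·[z,x] + D(z)·[x,y]. Then 3 u·[x,y,z] = [x·u, y, z] + [x, y·u, z] + [x, y, z·u] for all x,y,z,u ∈ L. -/
variable {K L : Type*} [Field K] [CharZero K] [AddCommGroup L] [Module K L]

theorem stmt17
    (mul br : L →ₗ[K] L →ₗ[K] L)
    (hcomm : ∀ x y : L, mul x y = mul y x)
    (hassoc : ∀ x y z : L, mul (mul x y) z = mul x (mul y z))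
    (hskew : ∀ x y : L, br x y = - br y x)
    (hjac : ∀ x y z : L, br (br x y) z + br (br y z) x + br (br z x) y = 0)
    (htl : ∀ x y z : L, (2 : K) • mul z (br x y) = br (mul z x) y + br x (mul z y))
    (D : L →ₗ[K] L)
    (hDmul : ∀ x y : L, D (mul x y) = mul (D x) y + mul x (D y))
    (hDbr : ∀ x y : L, D (br x y) = br (D x) y + br x (D y))
    (t : L → L → L → L)
    (ht : ∀ x y z : L,
      t x y z = mul (D x) (br y z) + mul (D y) (br z x) + mul (D z) (br x y)) :
    ∀ x y z u : L,
      (3 : K) • mul u (t x y z) = t (mul x u) y z + t x (mul y u) z + t x y (mul z u) := by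
  intro x y z u
  have hcyc : mul x (br y z) + mul y (br z x) + mul z (br x y) = 0 := by
    have h2 : (2 : K) • (mul x (br y z) + mul y (br z x) + mul z (br x y)) = 0 := by
      rw [smul_add, smul_add, htl, htl, htl, hcomm y x, hcomm z x, hcomm z y,
        hskew y (mul x z), hskew z (mul x y), hskew x (mul y z)]
      abel
    exact (smul_eq_zero.mp h2).resolve_left two_ne_zero
  have e : ∀ a b c : L, mul a (br (mul b u) c) + mul a (br b (mul c u))
      = (2 : K) • mul u (mul a (br b c)) := by
    intro a b c
    rw [← map_add, hcomm b u, hcomm c u, ← htl, map_smul, ← hassoc, hcomm a u, hassoc]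
  have f : ∀ a w : L, mul (D (mul a u)) w = mul u (mul (D a) w) + mul (D u) (mul a w) := by
    intro a w
    rw [hDmul, map_add, LinearMap.add_apply, hcomm (D a) u, hassoc, hcomm a (D u), hassoc]
  have h0 : mul (D u) (mul x (br y z)) + mul (D u) (mul y (br z x))
      + mul (D u) (mul z (br x y)) = 0 := by
    rw [← map_add, ← map_add, hcyc, map_zero]
  have e1 := e (D x) y z
  have e2 := e (D y) z x
  have e3 := e (D z) x y
  rw [ht, ht, ht, ht, f, f, f, map_add, map_add]
  linear_combination (norm := module) -e1 - e2 - e3 - h0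
end

section
/- Let (L, ·, [ , ]) be a transposed Poisson algebra over a field of characteristic zero and let f : L → L be a linear map with f² = id that is an algebra endomorphism of (L,·) (i.e. f(x·y) = f(x)·f(y)) and satisfies f([x,y]) = −[f(x), f(y)] for all x,y ∈ L. Define the ternary operation [x,y,z] := f(x)·[y,z] + f(y)·[z,x] + f(z)·[x,y]. Then (L, [ , , ]) is a 3-Lie algebra: [ , , ] is trilinear, alternating, and satisfies the Fundamental Identity [[x,y,z],u,v] = [[x,u,v],y,z] + [[y,u,v],z,x] + [[z,u,v],x,y] for all x,y,z,u,v ∈ L. -/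
variable {K L : Type*} [Field K] [CharZero K] [AddCommGroup L] [Module K L]

theorem stmt18
    (mul br : L →ₗ[K] L →ₗ[K] L)
    (hcomm : ∀ x y : L, mul x y = mul y x)
    (hassoc : ∀ x y z : L, mul (mul x y) z = mul x (mul y z))
    (hskew : ∀ x y : L, br x y = - br y x)
    (hjac : ∀ x y z : L, br (br x y) z + br (br y z) x + br (br z x) y = 0)
    (htl : ∀ x y z : L, (2 : K) • mul z (br x y) = br (mul z x) y + br x (mul z y))
    (f : L →ₗ[K] L)
    (hinv : ∀ x : L, f (f x) = x)
    (hfmul : ∀ x y : L, f (mul x y) = mul (f x) (f y))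
    (hfbr : ∀ x y : L, f (br x y) = - br (f x) (f y))
    (t : L → L → L → L)
    (ht : ∀ x y z : L,
      t x y z = mul (f x) (br y z) + mul (f y) (br z x) + mul (f z) (br x y)) :
    (∀ x y z : L, t x y z = - t y x z) ∧
    (∀ x y z : L, t x y z = - t x z y) ∧
    (∀ x y z u v : L,
      t (t x y z) u v = t (t x u v) y z + t (t y u v) z x + t (t z u v) x y) := by
  have two : ∀ a b : L, (2 : K) • a = (2 : K) • b → a = b := fun a b h =>
    smul_right_injective L (two_ne_zero : (2 : K) ≠ 0) h
  have h1 : ∀ x y z : L, mul x (br y z) + mul y (br z x) + mul z (br x y) = 0 := by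
    intro x y z
    apply two
    rw [smul_add, smul_add, htl, htl, htl, hcomm y x, hcomm z x, hcomm z y,
      hskew y (mul x z), hskew z (mul x y), hskew x (mul y z)]
    module
  have h2 : ∀ h x y z : L,
      br (mul h (br x y)) z + br (mul h (br y z)) x + br (mul h (br z x)) y = 0 := by
    intro h x y z
    have a1 := htl (br x y) z h
    have a2 := htl (br y z) x h
    have a3 := htl (br z x) y h
    have a0 := congrArg (fun w => (2 : K) • mul h w) (hjac x y z)
    have b1 := congrArg (fun w => br w z) (htl x y h)
    have b2 := congrArg (fun w => br w x) (htl y z h)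
    have b3 := congrArg (fun w => br w y) (htl z x h)
    have c1 := hjac (mul h x) y z
    have c2 := hjac x (mul h y) z
    have c3 := hjac x y (mul h z)
    simp only [map_add, map_smul, LinearMap.add_apply, LinearMap.smul_apply, map_zero,
      smul_zero, smul_add] at a0 b1 b2 b3
    linear_combination (norm := module) b1 + b2 + b3 + c1 + c2 + c3 + a1 + a2 + a3 - a0
  have hE : ∀ a b x y : L, (2 : K) • mul (mul a b) (br x y)
      = br (mul a x) (mul b y) + br (mul b x) (mul a y) := by
    intro a b x y
    have e1 := congrArg (fun w => (2 : K) • mul a w) (htl x y b)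
    have e2 := htl (mul b x) y a
    have e3 := htl x (mul b y) a
    have e4 := htl x y (mul a b)
    simp only [map_add, map_smul, smul_add, ← hassoc] at e1 e2 e3 e4
    linear_combination (norm := module) e1 + e2 + e3 - e4
  have hJ : ∀ X Y z w : L, mul X (br z (mul Y w)) - mul Y (br z (mul X w))
      = mul (mul z (br X Y)) w := by
    intro X Y z w
    apply two
    have e1 := htl z (mul Y w) X
    have e2 := htl z (mul X w) Y
    have e3 := hE z w X Y
    have e4 : mul (mul z (br X Y)) w = mul (mul z w) (br X Y) := by
      rw [hassoc, hassoc, hcomm w]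
    have e5 : mul X (mul Y w) = mul Y (mul X w) := by
      rw [← hassoc, ← hassoc, hcomm X Y]
    have e6 := hskew (mul w X) (mul z Y)
    rw [e4, e3, e6, hcomm z X, hcomm w Y, hcomm z Y, hcomm w X, smul_sub, e1, e2, e5]
    module
  have cI : ∀ U X v y z : L, mul U (br v (mul X (br y z))) =
      - mul (mul v (br X U)) (br y z) + mul X (br (mul U (br v y)) z)
        + mul X (br y (mul U (br v z))) := by
    intro U X v y z
    have e1 := hJ X U v (br y z)
    have e2 := congrArg (mul X) (h2 U v y z)
    rw [hskew (mul U (br y z)) v, hskew z v, map_neg, map_neg, LinearMap.neg_apply,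
      ← hskew y] at e2
    simp only [map_add, map_neg, map_zero] at e2
    linear_combination (norm := module) -e1 - e2
  have cI' : ∀ V X u y z : L, mul V (br (mul X (br y z)) u) =
      - mul (mul u (br V X)) (br y z) + mul X (br (mul V (br y u)) z)
        + mul X (br y (mul V (br z u))) := by
    intro V X u y z
    have e := cI V X u y z
    rw [hskew (mul X (br y z)) u, hskew V X, hskew y u, hskew z u]
    simp only [map_neg, LinearMap.neg_apply]
    rw [e]
    module
  have cJ : ∀ X Y z w : L, - mul (mul z (br X Y)) w =
      mul Y (br z (mul X w)) + mul X (br (mul Y w) z) := by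
    intro X Y z w
    rw [← hJ, hskew (mul Y w) z, map_neg]
    module
  refine ⟨?_, ?_, ?_⟩
  · intro x y z
    rw [ht, ht, hskew z x, hskew z y, hskew y x]
    simp only [map_neg]
    module
  · intro x y z
    rw [ht, ht, hskew z x, hskew z y, hskew y x]
    simp only [map_neg]
    module
  · intro x y z u v
    have k := congrArg (fun w => mul w (br (f u) (f v))) (h1 x y z)
    simp only [map_add, LinearMap.add_apply, map_zero, LinearMap.zero_apply] at k
    have sw : ∀ a b c : L, mul (mul a b) c = mul (mul a c) b := by
      intro a b c
      rw [hassoc, hassoc, hcomm b]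
    rw [sw x, sw y, sw z] at k
    have i1 := cI (f u) (f x) v y z
    have i2 := cI (f u) (f y) v z x
    have i3 := cI (f u) (f z) v x y
    have j1 := cI' (f v) (f x) u y z
    have j2 := cI' (f v) (f y) u z x
    have j3 := cI' (f v) (f z) u x y
    have l1 := cJ (f x) (f y) z (br u v)
    have l2 := cJ (f y) (f z) x (br u v)
    have l3 := cJ (f z) (f x) y (br u v)
    simp only [ht, map_add, map_neg, hfmul, hfbr, hinv, LinearMap.add_apply,
      LinearMap.neg_apply]
    linear_combination (norm := module) i1 + i2 + i3 + j1 + j2 + j3 + l1 + l2 + l3 + k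
end

section
/- Let (L, ·, [ , ]) be a Poisson algebra over a field of characteristic zero. Define the ternary operation [x,y,z] := x·[y,z] + y·[z,x] + z·[x,y]. Then 3 u·[x,y,z] = [u·x, y, z] + [x, u·y, z] + [x, y, u·z] for all x,y,z,u ∈ L. -/
variable {K L : Type*} [Field K] [CharZero K] [AddCommGroup L] [Module K L]

theorem stmt19
    (mul br : L →ₗ[K] L →ₗ[K] L)
    (hcomm : ∀ x y : L, mul x y = mul y x)
    (hassoc : ∀ x y z : L, mul (mul x y) z = mul x (mul y z))
    (hskew : ∀ x y : L, br x y = - br y x)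
    (hjac : ∀ x y z : L, br (br x y) z + br (br y z) x + br (br z x) y = 0)
    (hleib : ∀ x y z : L, br x (mul y z) = mul (br x y) z + mul y (br x z))
    (t : L → L → L → L)
    (ht : ∀ x y z : L,
      t x y z = mul x (br y z) + mul y (br z x) + mul z (br x y)) :
    ∀ x y z u : L,
      (3 : K) • mul u (t x y z) = t (mul u x) y z + t x (mul u y) z + t x y (mul u z) := by
  intro x y z u
  have hlc : ∀ a b c : L, mul a (mul b c) = mul b (mul a c) := by
    intro a b c
    rw [← hassoc, hcomm a b, hassoc]
  have hl2 : ∀ a b c : L, br (mul a b) c = - (mul b (br c a)) - mul a (br c b) := by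
    intro a b c
    rw [hskew, hleib, hcomm (br c a) b]
    abel
  have hl1 : ∀ a b c : L, br a (mul b c) = mul c (br a b) + mul b (br a c) := by
    intro a b c
    rw [hleib, hcomm (br a b) c]
  have h3 : ∀ v : L, (3 : K) • v = v + v + v := by
    intro v
    module
  rw [h3]
  simp only [ht, hl1, hl2, hassoc, map_add, map_sub, map_neg]
  rw [hskew x z, hskew y x, hskew z y]
  simp only [map_neg]
  rw [hlc y u, hlc z u, hlc x u, hlc y x, hlc z x, hlc z y]
  abel
end
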